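/- arXiv:1812.00802 — 2 statements merged into one kernel-verified Lean document; each statement's English description precedes it below -/
import Mathlib

section
/- Let N_u ≤ N_RF ≤ N_r, let λ > 0, and let H ∈ ℂ^{N_r×N_u} satisfy H^H H = λ·I_{N_u} (all squared singular values of H equal λ). Then for every combiner W ∈ ℂ^{N_r×N_RF} with orthonormal columns (W^H W = I_{N_RF}), the mutual information satisfies C(W) ≤ N_u · log₂( 1 + αλN_RF / (λ N_u (1−α) + N_RF/ρ) ). -/
open Matrix BigOperators Filter Topology

/-- The quantized mutual information `C(W)` for channel `H`, combiner `W`,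
SNR `ρ` and quantization gain `α` (with `β = 1 - α`):
`C(W) = log₂ det( I + (α/β)·(diag{WᴴHHᴴW} + (1/(βρ))I)⁻¹ · WᴴHHᴴW )`. -/
noncomputable def MI (ρ α : ℝ) {Nr Nu NRF : ℕ} (H : Matrix (Fin Nr) (Fin Nu) ℂ)
    (W : Matrix (Fin Nr) (Fin NRF) ℂ) : ℝ :=
  let A : Matrix (Fin NRF) (Fin NRF) ℂ := Wᴴ * H * Hᴴ * W
  let M : Matrix (Fin NRF) (Fin NRF) ℂ :=
    1 + ((α / (1 - α) : ℝ) : ℂ) •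
      ((Matrix.diagonal A.diag + ((1 / ((1 - α) * ρ) : ℝ) : ℂ) • 1)⁻¹ * A)
  Real.logb 2 M.det.re


open scoped ComplexOrder

lemma aux_prod_le {n : ℕ} (x : Fin n → ℝ) (hx : ∀ i, 0 ≤ x i) (t : ℝ) (ht : 0 < t)
    (hs : ∑ i, x i ≤ n * t) : ∏ i, x i ≤ t ^ n := by
  have h : ∀ i, x i ≤ t * Real.exp (x i / t - 1) := by
    intro i
    have := Real.add_one_le_exp (x i / t - 1)
    calc x i = t * (x i / t - 1 + 1) := by field_simp; ring
      _ ≤ _ := by gcongr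
  calc ∏ i, x i ≤ ∏ i, (t * Real.exp (x i / t - 1)) :=
        Finset.prod_le_prod (fun i _ => hx i) (fun i _ => h i)
    _ = t ^ n * Real.exp ((∑ i, x i) / t - n) := by
        rw [Finset.prod_mul_distrib, ← Real.exp_sum]
        simp [Finset.sum_div]
    _ ≤ t ^ n * 1 := by
        gcongr
        rw [Real.exp_le_one_iff, sub_nonpos, div_le_iff₀ ht]
        exact hs
    _ = t ^ n := mul_one _

lemma aux_det_le {n : ℕ} (M : Matrix (Fin n) (Fin n) ℂ) (hM : M.PosSemidef) (t : ℝ) (ht : 0 < t)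
    (hs : M.trace.re ≤ n * t) : M.det.re ≤ t ^ n := by
  have h1 := hM.isHermitian.det_eq_prod_eigenvalues
  have h2 := hM.isHermitian.trace_eq_sum_eigenvalues
  have h3 : M.det.re = ∏ i, hM.isHermitian.eigenvalues i := by
    rw [h1, ← Complex.ofReal_re (∏ i, hM.isHermitian.eigenvalues i)]
    push_cast
    rfl
  have h4 : M.trace.re = ∑ i, hM.isHermitian.eigenvalues i := by
    rw [h2, ← Complex.ofReal_re (∑ i, hM.isHermitian.eigenvalues i)]
    push_cast
    rfl
  rw [h3]
  exact aux_prod_le _ hM.eigenvalues_nonneg t ht (h4 ▸ hs)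

lemma aux_tangent (d c m : ℝ) (hd : 0 ≤ d) (hc : 0 < c) (hm : 0 ≤ m) :
    d / (d + c) ≤ m / (m + c) + c / (m + c) ^ 2 * (d - m) := by
  have : m / (m + c) + c / (m + c) ^ 2 * (d - m) - d / (d + c)
      = c * (d - m) ^ 2 / ((m + c) ^ 2 * (d + c)) := by
    field_simp
    ring
  have h2 : 0 ≤ c * (d - m) ^ 2 / ((m + c) ^ 2 * (d + c)) := by positivity
  linarith

lemma aux_trace {Nr Nu NRF : ℕ} (H : Matrix (Fin Nr) (Fin Nu) ℂ) (W : Matrix (Fin Nr) (Fin NRF) ℂ)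
    (hW : Wᴴ * W = 1) (lam : ℝ) (hH : Hᴴ * H = (lam : ℂ) • 1) :
    ((Hᴴ * W) * (Hᴴ * W)ᴴ).trace.re ≤ lam * Nu := by
  have hP : ((H - W * (Wᴴ * H))ᴴ * (H - W * (Wᴴ * H))) = (lam : ℂ) • 1 - (Hᴴ * W) * (Hᴴ * W)ᴴ := by
    have e : Wᴴ * (W * (Wᴴ * H)) = Wᴴ * H := by
      rw [← Matrix.mul_assoc, hW, Matrix.one_mul]
    simp only [conjTranspose_sub, conjTranspose_mul, conjTranspose_conjTranspose, Matrix.sub_mul,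
      Matrix.mul_sub, Matrix.mul_assoc, e, hH]
    abel
  have h0 := (posSemidef_conjTranspose_mul_self (H - W * (Wᴴ * H))).trace_nonneg
  rw [hP] at h0
  have h1 := (Complex.le_def.1 h0).1
  simp [trace_sub, trace_smul] at h1
  simpa using h1

theorem stmt0 (ρ α : ℝ) (hρ : 0 < ρ) (hα : α ∈ Set.Ioo (0 : ℝ) 1)
    (Nu NRF Nr : ℕ) (h1 : Nu ≤ NRF) (h2 : NRF ≤ Nr)
    (lam : ℝ) (hlam : 0 < lam)
    (H : Matrix (Fin Nr) (Fin Nu) ℂ)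
    (hH : Hᴴ * H = (lam : ℂ) • 1)
    (W : Matrix (Fin Nr) (Fin NRF) ℂ)
    (hW : Wᴴ * W = 1) :
    MI ρ α H W ≤
      Nu * Real.logb 2 (1 + α * lam * NRF / (lam * Nu * (1 - α) + NRF / ρ)) := by
  obtain ⟨hα0, hα1⟩ := hα
  have hβ : 0 < 1 - α := by linarith
  set κ : ℝ := α / (1 - α) with hκ
  set c : ℝ := 1 / ((1 - α) * ρ) with hc
  have hκ0 : 0 < κ := by positivity
  have hc0 : 0 < c := by positivity
  set G : Matrix (Fin Nu) (Fin NRF) ℂ := Hᴴ * W with hG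
  let d : Fin NRF → ℝ := fun i => ∑ k, Complex.normSq (G k i)
  have hd : ∀ i, 0 ≤ d i := fun i => Finset.sum_nonneg fun k _ => Complex.normSq_nonneg _
  have hA : Wᴴ * H * Hᴴ * W = Gᴴ * G := by
    simp [hG, conjTranspose_mul, Matrix.mul_assoc]
  have hdiag : ∀ i, (Gᴴ * G) i i = (d i : ℂ) := by
    intro i
    simp [d, Matrix.mul_apply, Complex.normSq_eq_conj_mul_self]
  have hS : ∑ i, d i ≤ lam * Nu := by
    have h := aux_trace H W hW lam hH
    rw [← hG, trace_mul_comm] at h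
    simpa [trace, hdiag] using h
  set E : Matrix (Fin NRF) (Fin NRF) ℂ := diagonal fun i => ((1 / (d i + c) : ℝ) : ℂ) with hE
  have hinv : (Matrix.diagonal (Gᴴ * G).diag + (c : ℂ) • (1 : Matrix (Fin NRF) (Fin NRF) ℂ))⁻¹ = E := by
    apply Matrix.inv_eq_right_inv
    rw [smul_one_eq_diagonal, diagonal_add, hE, diagonal_mul_diagonal, ← diagonal_one]
    congr 1
    ext i
    have : d i + c ≠ 0 := by have := hd i; positivity
    rw [diag_apply, hdiag, ← Complex.ofReal_add, ← Complex.ofReal_mul, mul_one_div_cancel this]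
    simp
  have hEpsd : E.PosSemidef := by
    rw [hE]
    apply PosSemidef.diagonal
    intro i
    have := hd i
    have h : (0 : ℝ) ≤ 1 / (d i + c) := by positivity
    simpa only [Pi.zero_apply] using Complex.zero_le_real.2 h
  have hBpsd : (G * E * Gᴴ).PosSemidef := hEpsd.mul_mul_conjTranspose_same G
  have hκc : (0 : ℂ) ≤ (κ : ℂ) := Complex.zero_le_real.2 hκ0.le
  have hpd : (1 + (κ : ℂ) • (G * E * Gᴴ)).PosDef := PosDef.one.add_posSemidef (hBpsd.smul hκc)
  have hdet : (1 + (κ : ℂ) • (E * (Gᴴ * G))).det = (1 + (κ : ℂ) • (G * E * Gᴴ)).det := by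
    have := det_one_add_mul_comm ((κ : ℂ) • (E * Gᴴ)) G
    simpa [Matrix.mul_assoc] using this
  have hMI : MI ρ α H W = Real.logb 2 (1 + (κ : ℂ) • (G * E * Gᴴ)).det.re := by
    rw [← hdet, ← hinv]
    simp only [MI, hA, hκ, hc]
  rw [hMI]
  rcases Nat.eq_zero_or_pos Nu with h0 | hNu
  · subst h0
    simp
  have hNRF : 0 < NRF := lt_of_lt_of_le hNu h1
  have hNu' : (0 : ℝ) < Nu := by exact_mod_cast hNu
  have hNR' : (0 : ℝ) < NRF := by exact_mod_cast hNRF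
  set t : ℝ := 1 + α * lam * NRF / (lam * Nu * (1 - α) + NRF / ρ) with ht
  have ht0 : 0 < t := by positivity
  have htr : (G * E * Gᴴ).trace.re = ∑ i, d i / (d i + c) := by
    rw [Matrix.mul_assoc, trace_mul_comm, Matrix.mul_assoc, hE]
    have : ∀ i, (diagonal (fun i => ((1 / (d i + c) : ℝ) : ℂ)) * (Gᴴ * G)) i i
        = ((d i / (d i + c) : ℝ) : ℂ) := by
      intro i
      rw [diagonal_mul, hdiag, ← Complex.ofReal_mul]
      congr 1
      ring
    rw [trace, Complex.re_sum]
    refine Finset.sum_congr rfl fun i _ => ?_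
    rw [diag_apply, this, Complex.ofReal_re]
  have hsum : ∑ i, d i / (d i + c) ≤ NRF * (lam * Nu / (lam * Nu + c * NRF)) := by
    set m : ℝ := lam * Nu / NRF with hm
    have hm0 : 0 < m := by positivity
    calc ∑ i, d i / (d i + c) ≤ ∑ i, (m / (m + c) + c / (m + c) ^ 2 * (d i - m)) :=
          Finset.sum_le_sum fun i _ => aux_tangent _ _ _ (hd i) hc0 hm0.le
      _ = NRF * (m / (m + c)) + c / (m + c) ^ 2 * (∑ i, d i - NRF * m) := by
          rw [Finset.sum_add_distrib, ← Finset.mul_sum, Finset.sum_sub_distrib]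
          simp
      _ ≤ NRF * (m / (m + c)) + 0 := by
          gcongr
          apply mul_nonpos_of_nonneg_of_nonpos (by positivity)
          have : NRF * m = lam * Nu := by rw [hm]; field_simp
          linarith
      _ = _ := by
          rw [hm]; field_simp; ring
  have hle : (1 + (κ : ℂ) • (G * E * Gᴴ)).trace.re ≤ Nu * t := by
    have e : (1 + (κ : ℂ) • (G * E * Gᴴ)).trace.re = Nu + κ * ∑ i, d i / (d i + c) := by
      rw [← htr]
      simp [trace_add, trace_smul]
    rw [e]
    calc _ ≤ Nu + κ * (NRF * (lam * Nu / (lam * Nu + c * NRF))) := by gcongr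
      _ = Nu * t := by
        rw [ht, hκ, hc]
        field_simp
  have hfin := aux_det_le _ hpd.posSemidef t ht0 hle
  have hpos : 0 < (1 + (κ : ℂ) • (G * E * Gᴴ)).det.re := (Complex.lt_def.1 hpd.det_pos).1
  rw [← Real.logb_pow]
  exact Real.logb_le_logb_of_le (by norm_num) hpos hfin
end

section
/- Let N_u ≤ N_RF ≤ N_r with N_u ≥ 1, and let H ∈ ℂ^{N_r×N_u} (so rank H ≤ N_u). Then for every combiner W ∈ ℂ^{N_r×N_RF} with orthonormal columns (W^H W = I_{N_RF}), the mutual information satisfies C(W) ≤ N_u · log₂( 1 + α N_RF / ((1−α) N_u) ). -/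
open Matrix BigOperators Filter Topology

open scoped ComplexOrder in
lemma posdef_log_det_le (n : ℕ) (S : Matrix (Fin n) (Fin n) ℂ) (hS : S.PosDef) (m : ℝ)
    (hm : 0 < m) (ht : S.trace.re ≤ n * m) : Real.log S.det.re ≤ n * Real.log m := by
  have hdet : S.det.re = ∏ i, hS.1.eigenvalues i := by
    rw [hS.1.det_eq_prod_eigenvalues, ← Complex.ofReal_re (∏ i, hS.1.eigenvalues i)]
    congr 1
    push_cast
    rfl
  have htr : S.trace.re = ∑ i, hS.1.eigenvalues i := by
    rw [hS.1.trace_eq_sum_eigenvalues, ← Complex.ofReal_re (∑ i, hS.1.eigenvalues i)]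
    congr 1
    push_cast
    rfl
  rw [hdet, Real.log_prod (fun i _ => (hS.eigenvalues_pos i).ne')]
  have key : ∀ i, Real.log (hS.1.eigenvalues i) ≤ hS.1.eigenvalues i / m - 1 + Real.log m := by
    intro i
    have h := Real.log_le_sub_one_of_pos (div_pos (hS.eigenvalues_pos i) hm)
    rw [Real.log_div (hS.eigenvalues_pos i).ne' hm.ne'] at h
    linarith
  refine (Finset.sum_le_sum (fun i _ => key i)).trans ?_
  rw [Finset.sum_add_distrib, Finset.sum_sub_distrib, ← Finset.sum_div, ← htr]
  have : S.trace.re / m ≤ n := (div_le_iff₀ hm).2 ht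
  simp
  linarith

open scoped ComplexOrder in
theorem stmt7 (ρ α : ℝ) (hρ : 0 < ρ) (hα : α ∈ Set.Ioo (0 : ℝ) 1)
    (Nu NRF Nr : ℕ) (hNu : 1 ≤ Nu) (h1 : Nu ≤ NRF) (h2 : NRF ≤ Nr)
    (H : Matrix (Fin Nr) (Fin Nu) ℂ)
    (W : Matrix (Fin Nr) (Fin NRF) ℂ)
    (hW : Wᴴ * W = 1) :
    MI ρ α H W ≤ Nu * Real.logb 2 (1 + α * NRF / ((1 - α) * Nu)) := by
  obtain ⟨h0, h1'⟩ := hα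
  have hβ : 0 < 1 - α := by linarith
  have hN : (0 : ℝ) < Nu := by exact_mod_cast hNu
  unfold MI
  have hA : Wᴴ * H * Hᴴ * W = (Hᴴ * W)ᴴ * (Hᴴ * W) := by
    simp [Matrix.conjTranspose_mul, Matrix.mul_assoc]
  simp only [hA]
  generalize hG : Hᴴ * W = G
  have hc : 0 < α / (1 - α) := by positivity
  have he : 0 < 1 / ((1 - α) * ρ) := by positivity
  have hcm : α * NRF / ((1 - α) * Nu) = α / (1 - α) * NRF / Nu := by
    field_simp
  rw [hcm]
  generalize α / (1 - α) = c at *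
  generalize 1 / ((1 - α) * ρ) = e at *
  set a : Fin NRF → ℝ := fun i => ∑ k, Complex.normSq (G k i) with ha
  have ha0 : ∀ i, 0 ≤ a i := fun i => Finset.sum_nonneg fun k _ => Complex.normSq_nonneg _
  have hdiag : ∀ i, (Gᴴ * G) i i = (a i : ℂ) := by
    intro i
    simp [Matrix.mul_apply, ha, Complex.normSq_eq_conj_mul_self]
  have hD : Matrix.diagonal (Gᴴ * G).diag + (e : ℂ) • (1 : Matrix (Fin NRF) (Fin NRF) ℂ)
      = Matrix.diagonal (fun i => ((a i + e : ℝ) : ℂ)) := by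
    ext i j
    by_cases hij : i = j
    · subst hij; simp [hdiag]
    · simp [hij]
  have hDi : (Matrix.diagonal (fun i => ((a i + e : ℝ) : ℂ)))⁻¹
      = Matrix.diagonal (fun i => (((a i + e)⁻¹ : ℝ) : ℂ)) := by
    apply Matrix.inv_eq_right_inv
    rw [Matrix.diagonal_mul_diagonal, ← Matrix.diagonal_one]
    congr 1
    funext i
    have : a i + e ≠ 0 := by have := ha0 i; positivity
    rw [← Complex.ofReal_mul, mul_inv_cancel₀ this, Complex.ofReal_one]
  rw [hD, hDi]
  set E : Matrix (Fin NRF) (Fin NRF) ℂ := Matrix.diagonal (fun i => (((a i + e)⁻¹ : ℝ) : ℂ)) with hE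
  have hdet : (1 + (c : ℂ) • (E * (Gᴴ * G))).det = (1 + (c : ℂ) • (G * E * Gᴴ)).det := by
    have := Matrix.det_one_add_mul_comm ((c : ℂ) • (E * Gᴴ)) G
    rw [Matrix.smul_mul, Matrix.mul_smul] at this
    rw [← Matrix.mul_assoc, this, Matrix.mul_assoc]
  rw [hdet]
  have hEp : E.PosSemidef := by
    rw [hE, Matrix.posSemidef_diagonal_iff]
    intro i
    have := ha0 i
    exact Complex.zero_le_real.2 (by positivity)
  have hS : (1 + (c : ℂ) • (G * E * Gᴴ)).PosDef :=
    Matrix.PosDef.one.add_posSemidef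
      ((hEp.mul_mul_conjTranspose_same G).smul (Complex.zero_le_real.2 hc.le))
  have htr : (G * E * Gᴴ).trace = ((∑ i, (a i + e)⁻¹ * a i : ℝ) : ℂ) := by
    rw [Matrix.mul_assoc, Matrix.trace_mul_comm, Matrix.mul_assoc]
    simp only [Matrix.trace, Matrix.diag_apply, hE, Matrix.diagonal_mul, hdiag]
    push_cast
    rfl
  have hsum : ∑ i, (a i + e)⁻¹ * a i ≤ NRF := by
    calc ∑ i, (a i + e)⁻¹ * a i ≤ ∑ i : Fin NRF, (1 : ℝ) := by
          apply Finset.sum_le_sum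
          intro i _
          have := ha0 i
          rw [inv_mul_le_iff₀ (by positivity)]
          linarith
      _ = NRF := by simp
  have hlog := posdef_log_det_le Nu _ hS (1 + c * NRF / Nu) (by positivity) (by
    rw [Matrix.trace_add, Matrix.trace_smul, htr, Matrix.trace_one, smul_eq_mul,
      ← Complex.ofReal_mul]
    have : (Nu : ℝ) * (1 + c * NRF / Nu) = Nu + c * NRF := by field_simp
    rw [this]
    simp only [Complex.add_re, Complex.ofReal_re, Fintype.card_fin, Complex.natCast_re]
    have := mul_le_mul_of_nonneg_left hsum hc.le
    linarith)
  rw [Real.logb, Real.logb, ← mul_div_assoc]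
  exact div_le_div_of_nonneg_right hlog (Real.log_nonneg (by norm_num))
end
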